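/- Let a₁, b₁ be reals with 0 < a₁ ≤ b₁, let (a_k, b_k) be the restriction intervals and (c⁽ᵏ⁾) the adaptivity sequence. Let n, N ≥ 1 and, for each worker j ∈ {1,…,N} and each k ≥ 0, let w_j⁽ᵏ⁾ : Fin n → ℝ be weight vectors whose entries lie in [a_k, b_k] for k ≥ 1, with w_j⁽⁰⁾ = w_j⁽¹⁾. Then for every k ≥ 1 and every pair of triples y = (u, v, λ), y′ = (u′, v′, λ′), one has the uniform comparison ‖y − y′‖²_{T⁽ᵏ⁾} ≤ (∏_{i=1}^{k} (1 + c⁽ⁱ⁾))·‖y − y′‖²_{T⁽⁰⁾}. -/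

import Mathlib

/-- Upper endpoint of the restriction interval at step `k`:
`b_k = a₁ * ((1/k²)·(b₁/a₁) + 1 − 1/k²)`. -/
noncomputable def bEnd (a₁ b₁ : ℝ) (k : ℕ) : ℝ :=
  a₁ * ((1 / (k : ℝ) ^ 2) * (b₁ / a₁) + 1 - 1 / (k : ℝ) ^ 2)

/-- Adaptivity sequence: `c⁽¹⁾ = b₁/a₁ − 1` and `c⁽ᵏ⁾ = b_{k−1}/a₁ − 1` for `k > 1`. -/
noncomputable def cSeq (a₁ b₁ : ℝ) (k : ℕ) : ℝ :=
  if k = 1 then b₁ / a₁ - 1 else bEnd a₁ b₁ (k - 1) / a₁ - 1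

/-- Weighted squared norm `‖x‖²_w = ∑ᵢ wᵢ·xᵢ²`. -/
noncomputable def wnormSq {n : ℕ} (w x : Fin n → ℝ) : ℝ := ∑ i, w i * x i ^ 2

/-- `T`-seminorm (squared) of a triple `y = (u, v, λ)` determined by the weights
`w_j`: `‖y‖²_T = ∑_j ‖v‖²_{w_j} + ∑_j ‖λ_j‖²_{1/w_j}` (the `u`-block carries zero
weight). -/
noncomputable def TnormSq {n N : ℕ} (w : Fin N → Fin n → ℝ)
    (v : Fin n → ℝ) (lam : Fin N → Fin n → ℝ) : ℝ :=
  (∑ j, wnormSq (w j) v) + ∑ j, wnormSq (fun i => 1 / w j i) (lam j)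

theorem bEnd_eq {a₁ : ℝ} (b₁ : ℝ) (ha : a₁ ≠ 0) (k : ℕ) :
    bEnd a₁ b₁ k = a₁ + (b₁ - a₁) * (1 / (k : ℝ) ^ 2) := by
  unfold bEnd
  generalize 1 / (k : ℝ) ^ 2 = t
  field_simp
  ring

theorem le_bEnd {a₁ b₁ : ℝ} (ha : 0 < a₁) (hab : a₁ ≤ b₁) (k : ℕ) : a₁ ≤ bEnd a₁ b₁ k := by
  rw [bEnd_eq b₁ ha.ne']
  have : 0 ≤ (b₁ - a₁) * (1 / (k : ℝ) ^ 2) := mul_nonneg (sub_nonneg.2 hab) (by positivity)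
  linarith

theorem bEnd_le {a₁ b₁ : ℝ} (ha : 0 < a₁) (hab : a₁ ≤ b₁) {k : ℕ} (hk : 1 ≤ k) :
    bEnd a₁ b₁ k ≤ b₁ := by
  have hk' : (1 : ℝ) ≤ k := by exact_mod_cast hk
  have ht : 1 / (k : ℝ) ^ 2 ≤ 1 := div_le_one_of_le₀ (one_le_pow₀ hk') (by positivity)
  rw [bEnd_eq b₁ ha.ne']
  have := mul_le_of_le_one_right (sub_nonneg.2 hab) ht
  linarith

theorem one_le_one_add_cSeq {a₁ b₁ : ℝ} (ha : 0 < a₁) (hab : a₁ ≤ b₁) (k : ℕ) :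
    1 ≤ 1 + cSeq a₁ b₁ k := by
  unfold cSeq
  split_ifs
  · have := (one_le_div ha).2 hab
    linarith
  · have := (one_le_div ha).2 (le_bEnd ha hab (k - 1))
    linarith

theorem div_le_prod_one_add_cSeq {a₁ b₁ : ℝ} (ha : 0 < a₁) (hab : a₁ ≤ b₁) {k : ℕ}
    (hk : 1 ≤ k) : b₁ / a₁ ≤ ∏ i ∈ Finset.Icc 1 k, (1 + cSeq a₁ b₁ i) := by
  induction k, hk using Nat.le_induction with
  | base => simp [cSeq]
  | succ k hk ih =>
    rw [Finset.prod_Icc_succ_top (by omega)]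
    have hpos : 0 ≤ b₁ / a₁ := div_nonneg (ha.le.trans hab) ha.le
    exact ih.trans (le_mul_of_one_le_right (hpos.trans ih) (one_le_one_add_cSeq ha hab _))

theorem wnormSq_le_mul {n : ℕ} {C : ℝ} {w w' : Fin n → ℝ} (h : ∀ i, w i ≤ C * w' i)
    (x : Fin n → ℝ) : wnormSq w x ≤ C * wnormSq w' x := by
  unfold wnormSq
  rw [Finset.mul_sum]
  refine Finset.sum_le_sum fun i _ => ?_
  rw [← mul_assoc]
  exact mul_le_mul_of_nonneg_right (h i) (sq_nonneg _)

theorem TnormSq_le_mul {n N : ℕ} {C : ℝ} {w w' : Fin N → Fin n → ℝ}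
    (h : ∀ j i, w j i ≤ C * w' j i) (h' : ∀ j i, 1 / w j i ≤ C * (1 / w' j i))
    (v : Fin n → ℝ) (lam : Fin N → Fin n → ℝ) :
    TnormSq w v lam ≤ C * TnormSq w' v lam := by
  unfold TnormSq
  rw [mul_add, Finset.mul_sum, Finset.mul_sum]
  exact add_le_add (Finset.sum_le_sum fun j _ => wnormSq_le_mul (h j) v)
    (Finset.sum_le_sum fun j _ => wnormSq_le_mul (h' j) (lam j))

/-- uniform comparison
`‖y − y′‖²_{T⁽ᵏ⁾} ≤ (∏_{i=1}^{k} (1 + c⁽ⁱ⁾))·‖y − y′‖²_{T⁽⁰⁾}`. -/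
theorem stmt8 (a₁ b₁ : ℝ) (ha : 0 < a₁) (hab : a₁ ≤ b₁)
    (n N : ℕ) (hn : 1 ≤ n) (hN : 1 ≤ N)
    (w : ℕ → Fin N → Fin n → ℝ)
    (hw : ∀ k : ℕ, 1 ≤ k → ∀ j i, w k j i ∈ Set.Icc a₁ (bEnd a₁ b₁ k))
    (hw0 : w 0 = w 1) :
    ∀ k : ℕ, 1 ≤ k → ∀ (v v' : Fin n → ℝ) (lam lam' : Fin N → Fin n → ℝ),
      TnormSq (w k) (v - v') (lam - lam') ≤
        (∏ i ∈ Finset.Icc 1 k, (1 + cSeq a₁ b₁ i)) *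
          TnormSq (w 0) (v - v') (lam - lam') := by
  intro k hk v v' lam lam'
  have hP := div_le_prod_one_add_cSeq ha hab hk
  have hb : 0 < b₁ := ha.trans_le hab
  refine TnormSq_le_mul (fun j i => ?_) (fun j i => ?_) _ _ <;>
    rw [hw0] <;>
    obtain ⟨hk₁, hk₂⟩ := hw k hk j i <;>
    obtain ⟨h₁, h₂⟩ := hw 1 le_rfl j i <;>
    have hpos : 0 < w 1 j i := ha.trans_le h₁
  · calc w k j i ≤ b₁ := hk₂.trans (bEnd_le ha hab hk)
      _ = b₁ / a₁ * a₁ := (div_mul_cancel₀ b₁ ha.ne').symm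
      _ ≤ _ := mul_le_mul hP h₁ ha.le ((div_pos hb ha).le.trans hP)
  · calc 1 / w k j i ≤ 1 / a₁ := one_div_le_one_div_of_le ha hk₁
      _ = b₁ / a₁ * (1 / b₁) := by field_simp
      _ ≤ _ := mul_le_mul hP (one_div_le_one_div_of_le hpos (h₂.trans (bEnd_le ha hab le_rfl)))
        (by positivity) ((div_pos hb ha).le.trans hP)
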